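/- Let n, k ≥ 2 be integers and fix p with 1 ≤ p ≤ ∞. Define, for natural numbers s, t, the mapping ratio e_ρ(ℤ^n, ℤ^k, s, t) = #{(u,v) ∈ ℤ^n×ℤ^k : ‖u‖_p ≤ s, ‖v‖_p ≤ t, and φ(u) = v for some group homomorphism φ : ℤ^n → ℤ^k} / (#{u ∈ ℤ^n : ‖u‖_p ≤ s} · #{v ∈ ℤ^k : ‖v‖_p ≤ t}). Then limsup_{(s,t)→(∞,∞)} e_ρ(ℤ^n, ℤ^k, s, t) ≤ 1 − (1/ζ(k))(1 − 1/ζ(n)). -/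

import Mathlib

open Filter

/-- The Riemann zeta function at a natural number argument, ζ(r) = Σ_{m≥1} m^{-r}. -/
noncomputable def zetaR (r : ℕ) : ℝ := ∑' m : ℕ, 1 / ((m : ℝ) + 1) ^ r

/-- The ℓ_p length of an integer vector, for an extended exponent `p` with `1 ≤ p ≤ ∞`:
the sup-norm when `p = ∞`, and `(Σ_i |z_i|^p)^{1/p}` for finite `p`. -/
noncomputable def lpLen (p : ENNReal) {r : ℕ} (z : Fin r → ℤ) : ℝ :=
  if p = ⊤ then ((Finset.univ.sup fun i => (z i).natAbs : ℕ) : ℝ)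
  else (∑ i, |((z i : ℤ) : ℝ)| ^ p.toReal) ^ (1 / p.toReal)

/-- The `(s,t)`-mapping ratio `e_ρ(ℤ^n, ℤ^k, s, t)`: the proportion, among all pairs
`(u,v) ∈ ℤ^n × ℤ^k` with `‖u‖_p ≤ s` and `‖v‖_p ≤ t`, of those pairs for which `v` is the
image of `u` under some group homomorphism `ℤ^n → ℤ^k`. -/
noncomputable def eRho (p : ENNReal) (n k : ℕ) (s t : ℕ) : ℝ :=
  ({uv : (Fin n → ℤ) × (Fin k → ℤ) |
      lpLen p uv.1 ≤ (s : ℝ) ∧ lpLen p uv.2 ≤ (t : ℝ) ∧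
      ∃ φ : (Fin n → ℤ) →+ (Fin k → ℤ), φ uv.1 = uv.2}.ncard : ℝ) /
    (({u : Fin n → ℤ | lpLen p u ≤ (s : ℝ)}.ncard : ℝ) *
      ({v : Fin k → ℤ | lpLen p v ≤ (t : ℝ)}.ncard : ℝ))

section LpLength

variable {p : ENNReal} {r : ℕ}

theorem lpLen_eq_norm (hp : 1 ≤ p) (z : Fin r → ℤ) :
    lpLen p z = ‖WithLp.toLp p (fun i => (z i : ℝ))‖ := by
  unfold lpLen
  split_ifs with h
  · subst h
    rw [PiLp.norm_toLp, Pi.norm_def, ← NNReal.coe_natCast, NNReal.coe_inj,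
      Finset.apply_sup_eq_sup_comp (fun n : ℕ => (n : NNReal)) Nat.cast_max (by simp)]
    refine Finset.sup_congr rfl fun i _ => ?_
    ext
    simp [Nat.cast_natAbs]
  · rw [PiLp.norm_eq_sum (ENNReal.toReal_pos (by positivity) h)]
    simp

theorem abs_le_lpLen (hp : 1 ≤ p) (z : Fin r → ℤ) (i : Fin r) :
    ((z i).natAbs : ℝ) ≤ lpLen p z := by
  have : Fact (1 ≤ p) := ⟨hp⟩
  rw [lpLen_eq_norm hp]
  refine le_trans (le_of_eq ?_) (PiLp.norm_apply_le (WithLp.toLp p (fun i => (z i : ℝ))) i)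
  simp [Nat.cast_natAbs]

theorem lpLen_natCast_mul (hp : 1 ≤ p) (d : ℕ) (z : Fin r → ℤ) :
    lpLen p (fun i => (d : ℤ) * z i) = d * lpLen p z := by
  have : Fact (1 ≤ p) := ⟨hp⟩
  have h : WithLp.toLp p (fun i => (((d : ℤ) * z i : ℤ) : ℝ)) =
      (d : ℝ) • WithLp.toLp p (fun i => (z i : ℝ)) := by
    ext i
    simp
  rw [lpLen_eq_norm hp, lpLen_eq_norm hp, h, norm_smul]
  simp

theorem lpLen_zero (hp : 1 ≤ p) : lpLen p (0 : Fin r → ℤ) = 0 := by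
  simpa [← Pi.zero_def] using lpLen_natCast_mul hp 0 (0 : Fin r → ℤ)

/-- Integer points of the `ℓ_p`-ball of radius `x`. -/
def latticeBall (p : ENNReal) (r : ℕ) (x : ℝ) : Set (Fin r → ℤ) := {z | lpLen p z ≤ x}

theorem latticeBall_subset (hp : 1 ≤ p) (x : ℝ) :
    latticeBall p r x ⊆
      Fintype.piFinset fun _ : Fin r => Finset.Icc (-(⌊x⌋₊ : ℤ)) ⌊x⌋₊ := by
  intro z hz
  simp only [Finset.mem_coe, Fintype.mem_piFinset, Finset.mem_Icc]
  intro i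
  have := Nat.le_floor ((abs_le_lpLen hp z i).trans hz)
  omega

theorem finite_latticeBall (hp : 1 ≤ p) (x : ℝ) : (latticeBall p r x).Finite :=
  (Finset.finite_toSet _).subset (latticeBall_subset hp x)

theorem ncard_latticeBall_le (hp : 1 ≤ p) {x : ℝ} (hx : 1 ≤ x) :
    ((latticeBall p r x).ncard : ℝ) ≤ (3 * x) ^ r := by
  have h := Set.ncard_le_ncard (latticeBall_subset (r := r) hp x) (Finset.finite_toSet _)
  rw [Set.ncard_coe_finset, Fintype.card_piFinset] at h
  have hc : (Finset.Icc (-(⌊x⌋₊ : ℤ)) ⌊x⌋₊).card = 2 * ⌊x⌋₊ + 1 := by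
    rw [Int.card_Icc]
    omega
  simp only [hc, Finset.prod_const, Finset.card_univ, Fintype.card_fin] at h
  have h2 : ((latticeBall p r x).ncard : ℝ) ≤ (2 * ⌊x⌋₊ + 1 : ℝ) ^ r := by exact_mod_cast h
  refine h2.trans ?_
  have := Nat.floor_le (zero_le_one.trans hx)
  gcongr
  linarith

/-- The real `ℓ_p` unit ball. -/
def realBall (p : ENNReal) (r : ℕ) : Set (Fin r → ℝ) := {x | ‖WithLp.toLp p x‖ ≤ 1}

theorem realBall_subset (hp : 1 ≤ p) : realBall p r ⊆ Metric.closedBall 0 1 := by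
  have : Fact (1 ≤ p) := ⟨hp⟩
  intro x hx
  rw [mem_closedBall_zero_iff, pi_norm_le_iff_of_nonneg zero_le_one]
  exact fun i => (PiLp.norm_apply_le (WithLp.toLp p x) i).trans hx

theorem convex_realBall (hp : 1 ≤ p) : Convex ℝ (realBall p r) := by
  have : Fact (1 ≤ p) := ⟨hp⟩
  have h := (convex_closedBall (0 : PiLp p fun _ : Fin r => ℝ) 1).linear_preimage
    (WithLp.linearEquiv p ℝ (Fin r → ℝ)).symm.toLinearMap
  have hset : realBall p r =
      (WithLp.linearEquiv p ℝ (Fin r → ℝ)).symm.toLinearMap ⁻¹' Metric.closedBall 0 1 := by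
    ext x
    change ‖WithLp.toLp p x‖ ≤ 1 ↔ WithLp.toLp p x ∈ Metric.closedBall 0 1
    rw [mem_closedBall_zero_iff]
  rw [hset]
  exact h

theorem isClosed_realBall (hp : 1 ≤ p) : IsClosed (realBall p r) := by
  have : Fact (1 ≤ p) := ⟨hp⟩
  exact isClosed_le (PiLp.continuous_toLp p _).norm continuous_const

theorem volume_realBall_pos (hp : 1 ≤ p) : 0 < MeasureTheory.volume.real (realBall p r) := by
  have : Fact (1 ≤ p) := ⟨hp⟩
  have ho : IsOpen {x : Fin r → ℝ | ‖WithLp.toLp p x‖ < 1} :=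
    isOpen_lt (PiLp.continuous_toLp p _).norm continuous_const
  have hpos := ho.measure_pos MeasureTheory.volume ⟨0, by simp⟩
  refine ENNReal.toReal_pos (hpos.trans_le (MeasureTheory.measure_mono fun x hx => ?_)).ne' ?_
  · exact le_of_lt (Set.mem_ofPred.1 hx)
  · exact (Metric.isBounded_closedBall.subset (realBall_subset hp)).measure_lt_top.ne

theorem tendsto_ncard_latticeBall (hp : 1 ≤ p) :
    Tendsto (fun x : ℝ => ((latticeBall p r x).ncard : ℝ) / x ^ r) atTop
      (nhds (MeasureTheory.volume.real (realBall p r))) := by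
  have : Fact (1 ≤ p) := ⟨hp⟩
  have key := tendsto_card_div_pow_atTop_volume' (realBall p r)
    (Metric.isBounded_closedBall.subset (realBall_subset hp))
    (isClosed_realBall hp).measurableSet ((convex_realBall hp).addHaar_frontier _) (by
      rintro x y hx hxy _ ⟨v, hv, rfl⟩
      have hy := hx.trans_le hxy
      refine ⟨(x / y) • v, ?_, ?_⟩
      · change ‖WithLp.toLp p ((x / y) • v)‖ ≤ 1
        rw [WithLp.toLp_smul, norm_smul, Real.norm_of_nonneg (by positivity)]
        exact mul_le_one₀ ((div_le_one hy).2 hxy) (norm_nonneg _) hv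
      · simp only [smul_smul, mul_div_cancel₀ _ hy.ne'])
  refine key.congr' ?_
  filter_upwards [eventually_gt_atTop 0] with x hx
  rw [Fintype.card_fin]
  congr 2
  rw [Nat.card_coe_set_eq]
  have hinj : Function.Injective (fun (z : Fin r → ℤ) => x⁻¹ • (fun i => (z i : ℝ))) := by
    intro a b hab
    ext i
    have := congrFun hab i
    simpa [hx.ne'] using this
  rw [← Set.ncard_image_of_injective _ hinj]
  congr 1
  have hmem : ∀ z : Fin r → ℤ, x⁻¹ • (fun i => (z i : ℝ)) ∈ realBall p r ↔
      z ∈ latticeBall p r x := by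
    intro z
    change ‖WithLp.toLp p (x⁻¹ • (fun i => (z i : ℝ)))‖ ≤ 1 ↔ lpLen p z ≤ x
    rw [lpLen_eq_norm hp, WithLp.toLp_smul, norm_smul, Real.norm_of_nonneg (by positivity),
      inv_mul_le_iff₀ hx, mul_one]
  ext v
  constructor
  · rintro ⟨hv, w, hw, rfl⟩
    rw [SetLike.mem_coe, Module.Basis.mem_span_iff_repr_mem] at hw
    choose z hz using hw
    have hwz : w = fun i => (z i : ℝ) := by
      ext i
      simpa using (hz i).symm
    subst hwz
    exact ⟨z, (hmem z).1 hv, rfl⟩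
  · rintro ⟨z, hz, rfl⟩
    refine ⟨(hmem z).2 hz, _, ?_, rfl⟩
    rw [SetLike.mem_coe, Module.Basis.mem_span_iff_repr_mem]
    exact fun i => ⟨z i, by simp⟩

end LpLength

theorem tsum_moebius_div_pow {r : ℕ} (hr : 2 ≤ r) :
    ∑' d : ℕ, (ArithmeticFunction.moebius d : ℝ) / (d : ℝ) ^ r = 1 / zetaR r := by
  have hre : 1 < (r : ℂ).re := by
    rw [Complex.natCast_re]
    exact_mod_cast hr
  have h := ArithmeticFunction.LSeries_zeta_mul_Lseries_moebius hre
  rw [ArithmeticFunction.LSeries_zeta_eq_riemannZeta hre,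
    zeta_eq_tsum_one_div_nat_add_one_cpow hre] at h
  have hz : ∑' n : ℕ, 1 / ((n : ℂ) + 1) ^ (r : ℂ) = (zetaR r : ℂ) := by
    rw [zetaR, Complex.ofReal_tsum]
    refine tsum_congr fun n => ?_
    push_cast
    rw [Complex.cpow_natCast]
  have hm : LSeries (fun n => ((ArithmeticFunction.moebius n : ℤ) : ℂ)) (r : ℂ) =
      ((∑' d : ℕ, (ArithmeticFunction.moebius d : ℝ) / (d : ℝ) ^ r : ℝ) : ℂ) := by
    rw [LSeries, Complex.ofReal_tsum]
    refine tsum_congr fun n => ?_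
    rw [LSeries.term_def]
    split_ifs with hn
    · simp [hn]
    · push_cast
      rw [Complex.cpow_natCast]
  rw [hz, hm] at h
  exact eq_one_div_of_mul_eq_one_right (by exact_mod_cast h)

section Primitive

variable {p : ENNReal} {r : ℕ}

/-- The greatest common divisor of the coordinates of an integer vector. -/
def contentGcd (z : Fin r → ℤ) : ℕ := Finset.univ.gcd fun i => (z i).natAbs

theorem dvd_contentGcd_iff {d : ℕ} {z : Fin r → ℤ} :
    d ∣ contentGcd z ↔ ∀ i, (d : ℤ) ∣ z i := by
  simp [contentGcd, Finset.dvd_gcd_iff, Int.natCast_dvd]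

theorem contentGcd_eq_zero_iff {z : Fin r → ℤ} : contentGcd z = 0 ↔ z = 0 := by
  simp [contentGcd, Finset.gcd_eq_zero_iff, funext_iff]

/-- Primitive integer points of the `ℓ_p`-ball of radius `x`. -/
def primitiveBall (p : ENNReal) (r : ℕ) (x : ℝ) : Set (Fin r → ℤ) :=
  {z ∈ latticeBall p r x | contentGcd z = 1}

theorem contentGcd_le_lpLen (hp : 1 ≤ p) {z : Fin r → ℤ} (hz : z ≠ 0) :
    (contentGcd z : ℝ) ≤ lpLen p z := by
  obtain ⟨i, hi⟩ := Function.ne_iff.1 hz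
  refine le_trans ?_ (abs_le_lpLen hp z i)
  exact Nat.cast_le.2 <| Nat.le_of_dvd (Int.natAbs_pos.2 hi) <|
    Int.natCast_dvd.1 (dvd_contentGcd_iff.1 dvd_rfl i)

theorem ncard_latticeBall_diff_zero_le (hp : 1 ≤ p) {x : ℝ} (hx : 0 ≤ x) :
    ((latticeBall p r x \ {0}).ncard : ℝ) ≤ (3 * x) ^ r := by
  rcases le_or_gt 1 x with h | h
  · refine le_trans ?_ (ncard_latticeBall_le hp h)
    exact_mod_cast Set.ncard_le_ncard Set.sdiff_subset (finite_latticeBall hp x)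
  · have : latticeBall p r x \ {0} = ∅ := by
      rw [Set.eq_empty_iff_forall_notMem]
      rintro z ⟨hz, hz0⟩
      have h1 := (contentGcd_le_lpLen hp hz0).trans_lt (lt_of_le_of_lt hz h)
      have h2 : contentGcd z = 0 := by
        have : contentGcd z < 1 := by exact_mod_cast h1
        omega
      exact hz0 (contentGcd_eq_zero_iff.1 h2)
    rw [this, Set.ncard_empty, Nat.cast_zero]
    positivity

theorem zero_mem_latticeBall (hp : 1 ≤ p) {x : ℝ} (hx : 0 ≤ x) : 0 ∈ latticeBall p r x := by
  simpa [latticeBall, lpLen_zero hp] using hx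

theorem tendsto_ncard_latticeBall_diff_zero (hp : 1 ≤ p) (hr : r ≠ 0) :
    Tendsto (fun x : ℝ => ((latticeBall p r x \ {0}).ncard : ℝ) / x ^ r) atTop
      (nhds (MeasureTheory.volume.real (realBall p r))) := by
  have h1 : Tendsto (fun x : ℝ => (1 : ℝ) / x ^ r) atTop (nhds 0) :=
    tendsto_const_nhds.div_atTop (tendsto_pow_atTop hr)
  have h := (tendsto_ncard_latticeBall (r := r) hp).sub h1
  rw [sub_zero] at h
  refine h.congr' ?_
  filter_upwards [eventually_ge_atTop 0] with x hx
  have := Set.ncard_sdiff_singleton_add_one (zero_mem_latticeBall (r := r) hp hx)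
    (finite_latticeBall hp x)
  rw [← this]
  push_cast
  ring

theorem ncard_dvd_contentGcd (hp : 1 ≤ p) {d : ℕ} (hd : d ≠ 0) (x : ℝ) :
    {z ∈ latticeBall p r x \ {0} | d ∣ contentGcd z}.ncard =
      (latticeBall p r (x / d) \ {0}).ncard := by
  have hd' : (0 : ℝ) < d := by positivity
  have hinj : Function.Injective (fun (z : Fin r → ℤ) (i : Fin r) => (d : ℤ) * z i) := by
    intro a b hab
    ext i
    have := congrFun hab i
    simpa [hd] using this
  rw [← Set.ncard_image_of_injective (latticeBall p r (x / d) \ {0}) hinj]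
  congr 1
  ext z
  constructor
  · rintro ⟨⟨hz, hz0⟩, hdz⟩
    choose w hw using dvd_contentGcd_iff.1 hdz
    obtain rfl : z = fun i => (d : ℤ) * w i := funext hw
    refine ⟨w, ⟨?_, ?_⟩, rfl⟩
    · change lpLen p _ ≤ x at hz
      rw [lpLen_natCast_mul hp] at hz
      exact (le_div_iff₀' hd').2 hz
    · intro h
      rw [Set.mem_singleton_iff.1 h] at hz0
      exact hz0 (by ext i; simp)
  · rintro ⟨w, ⟨hw, hw0⟩, rfl⟩
    refine ⟨⟨?_, fun h => hw0 (hinj ?_)⟩, dvd_contentGcd_iff.2 fun i => dvd_mul_right _ _⟩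
    · change lpLen p _ ≤ x
      rw [lpLen_natCast_mul hp]
      exact (le_div_iff₀' hd').1 hw
    · rw [Set.mem_singleton_iff.1 h]
      ext i
      simp

theorem ncard_primitiveBall (hp : 1 ≤ p) (s : ℕ) :
    ((primitiveBall p r s).ncard : ℝ) = ∑' d : ℕ, (ArithmeticFunction.moebius d : ℝ) *
      ((latticeBall p r ((s : ℝ) / d) \ {0}).ncard : ℝ) := by
  classical
  have hfin : (latticeBall p r (s : ℝ) \ {0}).Finite := (finite_latticeBall hp _).sdiff
  set T := hfin.toFinset with hT
  have hP : ((primitiveBall p r s).ncard : ℝ) =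
      ∑ z ∈ T, if contentGcd z = 1 then (1 : ℝ) else 0 := by
    rw [Finset.sum_boole, ← Set.ncard_coe_finset]
    congr 2
    ext z
    simp only [primitiveBall, hT, Finset.coe_filter, Set.Finite.mem_toFinset, Set.mem_ofPred_eq,
      Set.mem_sdiff, Set.mem_singleton_iff]
    constructor
    · rintro ⟨h1, h2⟩
      exact ⟨⟨h1, fun h => by simp [contentGcd_eq_zero_iff.2 h] at h2⟩, h2⟩
    · rintro ⟨⟨h1, -⟩, h2⟩
      exact ⟨h1, h2⟩
  have hM : ∀ z ∈ T, (if contentGcd z = 1 then (1 : ℝ) else 0) =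
      ∑ d ∈ Finset.Icc 1 s, if d ∣ contentGcd z then (ArithmeticFunction.moebius d : ℝ) else 0 := by
    intro z hz
    obtain ⟨hz1, hz0⟩ := hfin.mem_toFinset.1 hz
    have hg0 : contentGcd z ≠ 0 := fun h => hz0 (contentGcd_eq_zero_iff.1 h)
    have hgs : contentGcd z ≤ s := by
      exact_mod_cast (contentGcd_le_lpLen hp hz0).trans hz1
    rw [← ArithmeticFunction.one_apply (R := ℝ), ← ArithmeticFunction.coe_moebius_mul_coe_zeta,
      ArithmeticFunction.coe_mul_zeta_apply, ← Finset.sum_filter]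
    refine Finset.sum_congr ?_ fun _ _ => rfl
    ext d
    simp only [Nat.mem_divisors, Finset.mem_filter, Finset.mem_Icc]
    constructor
    · rintro ⟨h1, -⟩
      exact ⟨⟨Nat.pos_of_dvd_of_pos h1 (by omega),
        (Nat.le_of_dvd (by omega) h1).trans hgs⟩, h1⟩
    · rintro ⟨-, h1⟩
      exact ⟨h1, hg0⟩
  have hcount : ∀ d : ℕ, d ≠ 0 → ((latticeBall p r ((s : ℝ) / d) \ {0}).ncard : ℝ) =
      ∑ z ∈ T, if d ∣ contentGcd z then (1 : ℝ) else 0 := by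
    intro d hd
    rw [← ncard_dvd_contentGcd hp hd, Finset.sum_boole, ← Set.ncard_coe_finset]
    congr 2
    ext z
    simp [hT]
  rw [hP, Finset.sum_congr rfl hM, Finset.sum_comm, tsum_eq_sum (s := Finset.Icc 1 s)]
  · refine Finset.sum_congr rfl fun d hd => ?_
    rw [hcount d (by have := (Finset.mem_Icc.1 hd).1; omega), Finset.mul_sum]
    simp
  · intro d hd
    rcases eq_or_ne d 0 with rfl | hd0
    · simp
    rw [hcount d hd0, Finset.sum_eq_zero, mul_zero]
    intro z hz
    obtain ⟨hz1, hz0⟩ := hfin.mem_toFinset.1 hz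
    have hg0 : contentGcd z ≠ 0 := fun h => hz0 (contentGcd_eq_zero_iff.1 h)
    have hgs : contentGcd z ≤ s := by
      exact_mod_cast (contentGcd_le_lpLen hp hz0).trans hz1
    refine if_neg fun h => hd (Finset.mem_Icc.2 ⟨by omega, ?_⟩)
    exact (Nat.le_of_dvd (by omega) h).trans hgs

theorem tendsto_ncard_primitiveBall (hp : 1 ≤ p) (hr : 2 ≤ r) :
    Tendsto (fun s : ℕ => ((primitiveBall p r s).ncard : ℝ) / (s : ℝ) ^ r) atTop
      (nhds (1 / zetaR r * MeasureTheory.volume.real (realBall p r))) := by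
  rw [← tsum_moebius_div_pow hr, ← tsum_mul_right]
  have hcongr : (fun s : ℕ => ((primitiveBall p r s).ncard : ℝ) / (s : ℝ) ^ r) =
      fun s : ℕ => ∑' d : ℕ, (ArithmeticFunction.moebius d : ℝ) *
        ((latticeBall p r ((s : ℝ) / d) \ {0}).ncard : ℝ) / (s : ℝ) ^ r := by
    ext s
    rw [ncard_primitiveBall hp, tsum_div_const]
  rw [hcongr]
  refine tendsto_tsum_of_dominated_convergence (bound := fun d : ℕ => 3 ^ r * (1 / (d : ℝ) ^ r))
    ((Real.summable_one_div_nat_pow.2 (by omega)).mul_left _) ?_ ?_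
  · intro d
    rcases eq_or_ne d 0 with rfl | hd
    · simp
    have hd' : (0 : ℝ) < d := by positivity
    have h1 : Tendsto (fun s : ℕ => (s : ℝ) / d) atTop atTop :=
      tendsto_natCast_atTop_atTop.atTop_div_const hd'
    refine (((tendsto_ncard_latticeBall_diff_zero (r := r) hp (by omega)).comp h1).const_mul
      ((ArithmeticFunction.moebius d : ℝ) / (d : ℝ) ^ r)).congr fun s => ?_
    simp only [Function.comp, div_pow]
    field_simp
  · filter_upwards [eventually_ge_atTop 1] with s hs d
    rcases eq_or_ne d 0 with rfl | hd
    · simp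
    have hs' : (0 : ℝ) < s := by positivity
    have hd' : (0 : ℝ) < d := by positivity
    rw [norm_div, norm_mul, Real.norm_of_nonneg (by positivity : (0 : ℝ) ≤ (s : ℝ) ^ r),
      Real.norm_of_nonneg (Nat.cast_nonneg _), div_le_iff₀ (by positivity)]
    have hmu : ‖(ArithmeticFunction.moebius d : ℝ)‖ ≤ 1 := by
      rw [Real.norm_eq_abs]
      exact_mod_cast ArithmeticFunction.abs_moebius_le_one (n := d)
    calc _ ≤ 1 * (3 * ((s : ℝ) / d)) ^ r := by
          gcongr
          exact ncard_latticeBall_diff_zero_le hp (by positivity)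
      _ = _ := by
          rw [one_mul, mul_pow, div_pow]
          ring

/-- The proportion of primitive vectors among the integer points of an `ℓ_p`-ball tends to
`1 / ζ(r)`. -/
theorem tendsto_primitive_ratio (hp : 1 ≤ p) (hr : 2 ≤ r) :
    Tendsto (fun s : ℕ => ((primitiveBall p r s).ncard : ℝ) / (latticeBall p r s).ncard) atTop
      (nhds (1 / zetaR r)) := by
  have hV := (volume_realBall_pos (r := r) hp).ne'
  have h := (tendsto_ncard_primitiveBall hp hr).div
    ((tendsto_ncard_latticeBall (r := r) hp).comp tendsto_natCast_atTop_atTop) hV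
  rw [mul_div_cancel_right₀ _ hV] at h
  refine h.congr' ?_
  filter_upwards [eventually_ge_atTop 1] with s hs
  have hs' : (s : ℝ) ^ r ≠ 0 := by positivity
  simp only [Pi.div_apply, Function.comp]
  rw [div_div_div_cancel_right₀ hs']

theorem contentGcd_eq_one_of_map {n k : ℕ} (φ : (Fin n → ℤ) →+ (Fin k → ℤ)) {u : Fin n → ℤ}
    (h : contentGcd (φ u) = 1) : contentGcd u = 1 := by
  choose w hw using dvd_contentGcd_iff.1 (dvd_refl (contentGcd u))
  have hu : u = contentGcd u • w := by
    ext i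
    simpa using hw i
  refine Nat.dvd_one.1 (h ▸ dvd_contentGcd_iff.2 fun i => ⟨φ w i, ?_⟩)
  conv_lhs => rw [hu, map_nsmul]
  simp

theorem eRho_le (hp : 1 ≤ p) (n k s t : ℕ) :
    eRho p n k s t ≤ 1 - ((primitiveBall p k t).ncard : ℝ) / (latticeBall p k t).ncard *
      (1 - ((primitiveBall p n s).ncard : ℝ) / (latticeBall p n s).ncard) := by
  have hfn := finite_latticeBall (r := n) hp s
  have hfk := finite_latticeBall (r := k) hp t
  have hPn : primitiveBall p n s ⊆ latticeBall p n s := fun z hz => hz.1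
  have hPk : primitiveBall p k t ⊆ latticeBall p k t := fun z hz => hz.1
  have hNn : (0 : ℝ) < (latticeBall p n s).ncard := by
    exact_mod_cast (Set.ncard_pos hfn).2 ⟨0, zero_mem_latticeBall hp (Nat.cast_nonneg _)⟩
  have hNk : (0 : ℝ) < (latticeBall p k t).ncard := by
    exact_mod_cast (Set.ncard_pos hfk).2 ⟨0, zero_mem_latticeBall hp (Nat.cast_nonneg _)⟩
  set G : Set ((Fin n → ℤ) × (Fin k → ℤ)) := {uv | lpLen p uv.1 ≤ (s : ℝ) ∧
    lpLen p uv.2 ≤ (t : ℝ) ∧ ∃ φ : (Fin n → ℤ) →+ (Fin k → ℤ), φ uv.1 = uv.2} with hG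
  set B := (latticeBall p n s \ primitiveBall p n s) ×ˢ primitiveBall p k t with hB
  have hdisj : Disjoint G B := by
    rw [Set.disjoint_left]
    rintro ⟨u, v⟩ ⟨-, -, φ, hφ⟩ ⟨⟨hu, hu'⟩, hv⟩
    exact hu' ⟨hu, contentGcd_eq_one_of_map φ (hφ ▸ hv.2)⟩
  have hsub : G ∪ B ⊆ latticeBall p n s ×ˢ latticeBall p k t := by
    rintro ⟨u, v⟩ (h | h)
    · exact ⟨h.1, h.2.1⟩
    · exact ⟨h.1.1, hPk h.2⟩
  have hfin := hfn.prod hfk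
  have hcard := Set.ncard_le_ncard hsub hfin
  rw [Set.ncard_union_eq hdisj (hfin.subset (Set.subset_union_left.trans hsub))
    (hfin.subset (Set.subset_union_right.trans hsub)), hB, Set.ncard_prod, Set.ncard_prod] at hcard
  have hdiff := Set.ncard_sdiff_add_ncard_of_subset hPn hfn
  have hcard' : (G.ncard : ℝ) + ((latticeBall p n s).ncard - (primitiveBall p n s).ncard) *
      (primitiveBall p k t).ncard ≤ (latticeBall p n s).ncard * (latticeBall p k t).ncard := by
    rw [← hdiff, Nat.cast_add, add_sub_cancel_right, ← Nat.cast_add, hdiff]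
    exact_mod_cast hcard
  change (G.ncard : ℝ) / ((latticeBall p n s).ncard * (latticeBall p k t).ncard) ≤ _
  rw [div_le_iff₀ (by positivity)]
  field_simp
  linarith

end Primitive

/-- For `n, k ≥ 2` and `1 ≤ p ≤ ∞`,
`limsup_{(s,t)→(∞,∞)} e_ρ(ℤ^n, ℤ^k, s, t) ≤ 1 − (1/ζ(k))(1 − 1/ζ(n))`. -/
theorem stmt_5 (n k : ℕ) (hn : 2 ≤ n) (hk : 2 ≤ k) (p : ENNReal) (hp : 1 ≤ p) :
    limsup (fun st : ℕ × ℕ => eRho p n k st.1 st.2) (atTop ×ˢ atTop) ≤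
      1 - 1 / zetaR k * (1 - 1 / zetaR n) := by
  have h := (((tendsto_primitive_ratio hp hk).comp (tendsto_snd (f := (atTop : Filter ℕ)))).mul
    (((tendsto_primitive_ratio hp hn).comp
      (tendsto_fst (g := (atTop : Filter ℕ)))).const_sub 1)).const_sub 1
  rw [← h.limsup_eq]
  refine limsup_le_limsup (Eventually.of_forall fun st => eRho_le hp n k st.1 st.2) ?_
    h.isBoundedUnder_le
  refine IsBoundedUnder.isCoboundedUnder_le ⟨0, eventually_map.2 (Eventually.of_forall fun st => ?_)⟩
  unfold eRho
  positivity
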